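/- Let A be a symmetric positive-definite real 3×3 matrix, let ω : ℝ → ℝ³ be continuous, and let X, Y : ℝ → ℝ³ be differentiable solutions of the parallel transport equation X'(t) = ½(A⁻¹(−X(t) × Aω(t) − ω(t) × AX(t)) − ω(t) × X(t)) (and the same equation for Y). Then t ↦ X(t)ᵀAY(t) is constant in t; i.e., parallel transport along the curve preserves the left-invariant metric ⟨·,·⟩_A. -/

import Mathlib

open scoped Matrix

/-- The right-hand side of the parallel transport equation along angular velocity `w`, at the vector `x`. -/
noncomputable def transportField (A : Matrix (Fin 3) (Fin 3) ℝ) (w x : Fin 3 → ℝ) : Fin 3 → ℝ :=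
  (1 / 2 : ℝ) • (A⁻¹.mulVec (-(crossProduct x (A.mulVec w))
    - crossProduct w (A.mulVec x)) - crossProduct w x)

theorem Matrix.IsSymm.dotProduct_mulVec_comm {n R : Type*} [Fintype n] [CommSemiring R]
    {A : Matrix n n R} (hA : A.IsSymm) (u v : n → R) :
    u ⬝ᵥ A.mulVec v = A.mulVec u ⬝ᵥ v := by
  rw [Matrix.dotProduct_mulVec, ← Matrix.mulVec_transpose, hA.eq]

/-- Pairing the transport field with `y` in the metric `A`, with `A⁻¹` eliminated. -/
theorem dotProduct_mulVec_transportField {A : Matrix (Fin 3) (Fin 3) ℝ} (hA : A.IsSymm)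
    (hdet : IsUnit A.det) (w x y : Fin 3 → ℝ) :
    y ⬝ᵥ A.mulVec (transportField A w x) =
      (1 / 2) * (y ⬝ᵥ (-(crossProduct x (A.mulVec w)) - crossProduct w (A.mulVec x))
        - A.mulVec y ⬝ᵥ crossProduct w x) := by
  rw [transportField, Matrix.mulVec_smul, Matrix.mulVec_sub, Matrix.mulVec_mulVec,
    Matrix.mul_nonsing_inv A hdet, Matrix.one_mulVec, dotProduct_smul,
    dotProduct_sub _ _ (A.mulVec _),
    hA.dotProduct_mulVec_comm y (crossProduct w x), smul_eq_mul]

/-- The transport field is skew-adjoint for the metric `A`. -/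
theorem transportField_skew {A : Matrix (Fin 3) (Fin 3) ℝ} (hA : A.IsSymm)
    (hdet : IsUnit A.det) (w x y : Fin 3 → ℝ) :
    transportField A w x ⬝ᵥ A.mulVec y + x ⬝ᵥ A.mulVec (transportField A w y) = 0 := by
  rw [hA.dotProduct_mulVec_comm (transportField A w x) y, dotProduct_comm,
    dotProduct_mulVec_transportField hA hdet, dotProduct_mulVec_transportField hA hdet]
  simp only [cross_apply, dotProduct, Fin.sum_univ_three, Pi.sub_apply, Pi.neg_apply,
    Matrix.cons_val]
  ring

theorem HasDerivAt.dotProduct {n : Type*} [Fintype n] {f g : ℝ → n → ℝ} {f' g' : n → ℝ} {t : ℝ}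
    (hf : HasDerivAt f f' t) (hg : HasDerivAt g g' t) :
    HasDerivAt (fun s => f s ⬝ᵥ g s) (f' ⬝ᵥ g t + f t ⬝ᵥ g') t := by
  simp only [_root_.dotProduct, ← Finset.sum_add_distrib]
  exact HasDerivAt.fun_sum fun i _ => (hasDerivAt_pi.1 hf i).mul (hasDerivAt_pi.1 hg i)

/-- Parallel transport along a curve in `SO(3)` with body angular velocity `ω`, given in the
Lie algebra by `Ẋ = ½(A⁻¹(−X × Aω − ω × AX) − ω × X)`, preserves the left-invariant metric
`⟨x,y⟩_A = xᵀAy` (A symmetric positive-definite): if `X` and `Y` both satisfy the parallel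
transport equation, then `XᵀAY` is constant in time. -/
theorem so3_parallel_transport_isometry (A : Matrix (Fin 3) (Fin 3) ℝ)
    (hsymm : A.IsSymm) (hpos : A.PosDef)
    (ω : ℝ → Fin 3 → ℝ) (hω : Continuous ω)
    (X Y : ℝ → Fin 3 → ℝ)
    (hX : ∀ t, HasDerivAt X
      ((1 / 2 : ℝ) • (A⁻¹.mulVec (-(crossProduct (X t) (A.mulVec (ω t)))
          - crossProduct (ω t) (A.mulVec (X t))) - crossProduct (ω t) (X t))) t)
    (hY : ∀ t, HasDerivAt Y
      ((1 / 2 : ℝ) • (A⁻¹.mulVec (-(crossProduct (Y t) (A.mulVec (ω t)))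
          - crossProduct (ω t) (A.mulVec (Y t))) - crossProduct (ω t) (Y t))) t) :
    ∀ s t : ℝ, X s ⬝ᵥ A.mulVec (Y s) = X t ⬝ᵥ A.mulVec (Y t) := by
  have hdet : IsUnit A.det := hpos.det_pos.ne'.isUnit
  have hderiv : ∀ t, HasDerivAt (fun s => X s ⬝ᵥ A.mulVec (Y s)) 0 t := fun t => by
    have hAY : HasDerivAt (fun s => A.mulVec (Y s))
        (A.mulVec (transportField A (ω t) (Y t))) t :=
      A.mulVecLin.toContinuousLinearMap.hasFDerivAt.comp_hasDerivAt t (hY t)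
    exact transportField_skew hsymm hdet (ω t) (X t) (Y t) ▸ (hX t).dotProduct hAY
  exact is_const_of_deriv_eq_zero (fun t => (hderiv t).differentiableAt) fun t => (hderiv t).deriv
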